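/- For k ∈ {19, 23}, the packing number A(6k+5,4,4) equals the Johnson bound J(6k+5,4,4); that is, A(119,4,4) = J(119,4,4) and A(143,4,4) = J(143,4,4). -/

import Mathlib

/-- A 3-(n,4,1) packing design (packing quadruple system PQS(n)) on the point
set `Fin n`: a collection of 4-element blocks such that every 3-element subset
of points is contained in at most one block. -/
def IsPQS (n : ℕ) (B : Finset (Finset (Fin n))) : Prop :=
  (∀ b ∈ B, b.card = 4) ∧
  ∀ t : Finset (Fin n), t.card = 3 → (B.filter (fun b => t ⊆ b)).card ≤ 1

/-- The packing number A(n,4,4): the maximum number of blocks in a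
3-(n,4,1) packing design. -/
noncomputable def packingNumber (n : ℕ) : ℕ :=
  sSup {N | ∃ B : Finset (Finset (Fin n)), IsPQS n B ∧ B.card = N}

/-- The Johnson bound J(n,4,4). -/
def johnsonBound (n : ℕ) : ℕ :=
  if n % 6 = 0 then n * ((n - 1) * ((n - 2) / 2) / 3) / 4 - 1
  else n * ((n - 1) * ((n - 2) / 2) / 3) / 4

/-- A block with points `a < b < c < d`. -/
structure Quad where
  /-- The first point. -/
  a : ℕ
  /-- The second point. -/
  b : ℕ
  /-- The third point. -/
  c : ℕ
  /-- The fourth point. -/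
  d : ℕ

/-- The four triples in a block. -/
def Quad.triples : Quad → List (ℕ × ℕ × ℕ)
  | ⟨a, b, c, d⟩ => [(a, b, c), (a, b, d), (a, c, d), (b, c, d)]

/-- The block on four given points, put in increasing order. -/
def Quad.sort (a b c d : ℕ) : Quad :=
  ⟨min (min a b) (min c d), min (max (min a b) (min c d)) (min (max a b) (max c d)),
    max (max (min a b) (min c d)) (min (max a b) (max c d)), max (max a b) (max c d)⟩

/-- The `i`-th power of the permutation whose cycles are the intervals of lengths `l` that start
at the points `s`, for `(s, l)` in the list. -/
def rotate (i x : ℕ) : List (ℕ × ℕ) → ℕ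
  | [] => x
  | (s, l) :: C => bif Nat.blt x (s + l) then s + (x - s + i) % l else rotate i x C

/-- The images of the blocks of `L` under the first `r` powers of the permutation with cycles `C`. -/
def develop (C : List (ℕ × ℕ)) (r : ℕ) (L : List Quad) : List Quad :=
  L.flatMap fun q => (List.range r).map fun i =>
    .sort (rotate i q.a C) (rotate i q.b C) (rotate i q.c C) (rotate i q.d C)

/-- The unions of an edge `e` from the first and an edge `f` from the second list of edges. -/
def joinEdges (E F : List (ℕ × ℕ)) : List Quad :=
  E.flatMap fun e => F.map fun f => ⟨e.1, e.2, f.1, f.2⟩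

/-- A one-factorization of the complete graph on six points. -/
def factorsSix : List (List (ℕ × ℕ)) :=
  [[(0, 1), (2, 3), (4, 5)],
   [(0, 2), (1, 4), (3, 5)],
   [(0, 3), (1, 5), (2, 4)],
   [(0, 4), (1, 3), (2, 5)],
   [(0, 5), (1, 2), (3, 4)]]

/-- A one-factorization of the complete graph on eighteen points, in which the first five factors
have their edges inside the intervals of length six. -/
def factorsEighteen : List (List (ℕ × ℕ)) :=
  (factorsSix.map fun F => (List.range 3).flatMap fun g =>
    F.map fun e => (6 * g + e.1, 6 * g + e.2)) ++
  (factorsSix.drop 1).flatMap fun F => (List.range 3).map fun s =>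
    F.flatMap fun e => (List.range 3).map fun i => (3 * e.1 + i, 3 * e.2 + (i + s) % 3)

/-- The pairs of points `p < q` below `s` in different intervals of length `m`. -/
def crossPairs (m s : ℕ) : List (ℕ × ℕ) :=
  (List.range s ×ˢ List.range s).filter fun p => Nat.blt (p.1 / m) (p.2 / m)

/-- The image of a list of blocks under a map of points. -/
def mapQuads (f : ℕ → ℕ) (L : List Quad) : List Quad :=
  L.map fun q => ⟨f q.a, f q.b, f q.c, f q.d⟩

/-- The map that moves the `i`-th interval of length `m` to the `f i`-th one. -/
def lift (m : ℕ) (f : ℕ → ℕ) (y : ℕ) : ℕ :=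
  m * f (y / m) + y % m

/-- The points of a block as a function of their index. -/
def Quad.get (q : Quad) : ℕ → ℕ
  | 0 => q.a
  | 1 => q.b
  | 2 => q.c
  | _ => q.d

/-- Replacing every point by `m` points and every block of `L` by a copy of `P`. -/
def inflate (m : ℕ) (P L : List Quad) : List Quad :=
  L.flatMap fun q => mapQuads (lift m q.get) P

/-- Replacing every point by `m` points and every pair in `L` by a copy of `P`. -/
def inflatePairs (m : ℕ) (P : List Quad) (L : List (ℕ × ℕ)) : List Quad :=
  L.flatMap fun p => mapQuads (lift m fun i => if i = 0 then p.1 else p.2) P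

/-- A transversal design on four groups of two points. -/
def transversalTwo : List Quad :=
  [⟨0, 2, 4, 6⟩, ⟨1, 3, 4, 6⟩, ⟨1, 2, 5, 6⟩, ⟨0, 3, 5, 6⟩, ⟨1, 2, 4, 7⟩, ⟨0, 3, 4, 7⟩, ⟨0, 2, 5, 7⟩,
   ⟨1, 3, 5, 7⟩]

/-- A transversal design on four groups of six points. -/
def transversalSix : List Quad :=
  (List.range 6).flatMap fun i => (List.range 6).flatMap fun j => (List.range 6).map fun k =>
    ⟨i, 6 + j, 12 + k, 18 + (36 - i - j - k) % 6⟩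

/-- The unions of two edges from corresponding one-factors on two sets of six points. -/
def pairsSix : List Quad :=
  factorsSix.flatMap fun F => joinEdges F (F.map fun e => (6 + e.1, 6 + e.2))

/-- The unions of an edge on eighteen points and an edge on a second set of eighteen points from
corresponding one-factors, where the second edge is not inside the last six points. -/
def pairsEighteen : List Quad :=
  factorsEighteen.flatMap fun F =>
    joinEdges F ((F.filter fun e => Nat.blt e.1 12).map fun e => (18 + e.1, 18 + e.2))

/-- Blocks on three groups of six points that cover the triples not inside a group. -/
def cqsEighteen : List Quad :=
  develop ((List.range 6).map fun k => (3 * k, 3)) 3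
    [⟨0, 1, 6, 14⟩, ⟨0, 1, 7, 15⟩, ⟨0, 1, 8, 9⟩, ⟨0, 1, 10, 17⟩, ⟨0, 1, 11, 13⟩, ⟨0, 1, 12, 16⟩,
     ⟨0, 3, 6, 9⟩, ⟨0, 3, 7, 10⟩, ⟨0, 3, 8, 14⟩, ⟨0, 3, 11, 17⟩, ⟨0, 3, 12, 15⟩, ⟨0, 3, 13, 16⟩,
     ⟨0, 4, 6, 11⟩, ⟨0, 4, 7, 9⟩, ⟨0, 4, 8, 10⟩, ⟨0, 4, 12, 17⟩, ⟨0, 4, 13, 15⟩, ⟨0, 4, 14, 16⟩,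
     ⟨0, 5, 6, 15⟩, ⟨0, 5, 7, 8⟩, ⟨0, 5, 9, 10⟩, ⟨0, 5, 11, 12⟩, ⟨0, 5, 13, 14⟩, ⟨0, 5, 16, 17⟩,
     ⟨0, 6, 7, 16⟩, ⟨0, 6, 8, 12⟩, ⟨0, 6, 10, 13⟩, ⟨0, 7, 12, 14⟩, ⟨0, 7, 13, 17⟩, ⟨0, 8, 11, 16⟩,
     ⟨0, 8, 15, 17⟩, ⟨0, 9, 11, 15⟩, ⟨0, 9, 12, 13⟩, ⟨0, 9, 14, 17⟩, ⟨0, 10, 11, 14⟩,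
     ⟨0, 10, 15, 16⟩, ⟨3, 4, 6, 13⟩, ⟨3, 4, 7, 17⟩, ⟨3, 4, 8, 9⟩, ⟨3, 4, 10, 16⟩, ⟨3, 4, 11, 12⟩,
     ⟨3, 4, 14, 15⟩, ⟨3, 6, 7, 12⟩, ⟨3, 6, 10, 15⟩, ⟨3, 6, 14, 17⟩, ⟨3, 7, 8, 15⟩, ⟨3, 7, 13, 14⟩,
     ⟨3, 8, 11, 13⟩, ⟨3, 8, 16, 17⟩, ⟨3, 9, 10, 17⟩, ⟨3, 9, 11, 14⟩, ⟨3, 9, 12, 16⟩,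
     ⟨3, 10, 12, 13⟩, ⟨3, 11, 15, 16⟩, ⟨6, 7, 14, 15⟩, ⟨6, 9, 12, 15⟩, ⟨6, 9, 13, 16⟩,
     ⟨6, 10, 12, 14⟩, ⟨6, 10, 16, 17⟩, ⟨6, 11, 12, 17⟩, ⟨6, 11, 13, 15⟩, ⟨6, 11, 14, 16⟩,
     ⟨9, 10, 14, 15⟩]

/-- The blocks of a quadruple system on ten points that are not inside
`{3 * i, 3 * i + 1, 3 * i + 2, 9}` for any `i`. -/
def quadsTen : List Quad :=
  [⟨0, 1, 3, 5⟩, ⟨0, 1, 4, 8⟩, ⟨0, 1, 6, 7⟩, ⟨0, 2, 3, 4⟩, ⟨0, 2, 5, 6⟩, ⟨0, 2, 7, 8⟩,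
   ⟨0, 3, 6, 8⟩, ⟨0, 3, 7, 9⟩, ⟨0, 4, 5, 7⟩, ⟨0, 4, 6, 9⟩, ⟨0, 5, 8, 9⟩, ⟨1, 2, 3, 7⟩,
   ⟨1, 2, 4, 5⟩, ⟨1, 2, 6, 8⟩, ⟨1, 3, 4, 6⟩, ⟨1, 3, 8, 9⟩, ⟨1, 4, 7, 9⟩, ⟨1, 5, 6, 9⟩,
   ⟨1, 5, 7, 8⟩, ⟨2, 3, 5, 8⟩, ⟨2, 3, 6, 9⟩, ⟨2, 4, 6, 7⟩, ⟨2, 4, 8, 9⟩, ⟨2, 5, 7, 9⟩,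
   ⟨3, 4, 7, 8⟩, ⟨3, 5, 6, 7⟩, ⟨4, 5, 6, 8⟩]

/-- Blocks on three groups of eighteen points and a stem of six points that cover the triples that
are not inside the union of a group and the stem. -/
def masterSixty : List Quad :=
  inflate 6 transversalSix quadsTen ++ inflatePairs 6 pairsSix (crossPairs 3 9)

/-- The pairs of cells of `masterSeventyTwo` over which there are blocks on two cells. -/
def pairsTwelve : List (ℕ × ℕ) :=
  [(0, 4), (0, 5), (0, 7), (0, 8), (1, 3), (1, 6), (1, 9), (1, 10), (2, 3), (2, 6), (2, 9),
   (2, 10), (3, 7), (3, 8), (4, 6), (4, 9), (4, 10), (5, 6), (5, 9), (5, 10), (7, 9), (7, 10),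
   (8, 9), (8, 10)]

/-- The blocks of cells of `masterSeventyTwo` over which there are blocks on four cells. -/
def quadsTwelve : List Quad :=
  [⟨0, 1, 3, 8⟩, ⟨0, 1, 4, 9⟩, ⟨0, 1, 5, 6⟩, ⟨0, 1, 7, 10⟩, ⟨0, 2, 3, 4⟩, ⟨0, 2, 5, 9⟩,
   ⟨0, 2, 6, 7⟩, ⟨0, 2, 8, 10⟩, ⟨0, 3, 5, 7⟩, ⟨0, 4, 5, 10⟩, ⟨0, 4, 6, 8⟩, ⟨0, 4, 7, 11⟩,
   ⟨0, 5, 8, 11⟩, ⟨0, 7, 8, 9⟩, ⟨1, 2, 3, 6⟩, ⟨1, 2, 9, 10⟩, ⟨1, 3, 4, 10⟩, ⟨1, 3, 5, 9⟩,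
   ⟨1, 3, 7, 11⟩, ⟨1, 4, 6, 11⟩, ⟨1, 5, 10, 11⟩, ⟨1, 6, 7, 9⟩, ⟨1, 6, 8, 10⟩, ⟨1, 8, 9, 11⟩,
   ⟨2, 3, 5, 10⟩, ⟨2, 3, 7, 9⟩, ⟨2, 3, 8, 11⟩, ⟨2, 4, 6, 10⟩, ⟨2, 4, 9, 11⟩, ⟨2, 5, 6, 11⟩,
   ⟨2, 6, 8, 9⟩, ⟨2, 7, 10, 11⟩, ⟨3, 4, 6, 7⟩, ⟨3, 4, 8, 9⟩, ⟨3, 5, 6, 8⟩, ⟨3, 7, 8, 10⟩,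
   ⟨4, 5, 6, 9⟩, ⟨4, 7, 9, 10⟩, ⟨4, 8, 10, 11⟩, ⟨5, 6, 7, 10⟩, ⟨5, 7, 9, 11⟩, ⟨5, 8, 9, 10⟩]

/-- Blocks on three groups of eighteen points, a group of twelve points and a stem of six points
that cover the triples that are not inside the union of a group and the stem. -/
def masterSeventyTwo : List Quad :=
  (inflate 6 transversalSix quadsTwelve ++ inflatePairs 6 pairsSix pairsTwelve) ++
  (mapQuads (lift 6 fun i => i + 1 + i / 2)
    (inflate 2 transversalTwo cqsEighteen ++ inflatePairs 2 [⟨0, 1, 2, 3⟩] (crossPairs 6 18)) ++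
  (mapQuads (lift 6 fun i => 3 * i) cqsEighteen ++
  mapQuads (lift 6 fun i => if i < 3 then 3 * i else i + 6) pairsEighteen))

/-- A packing on eleven points. -/
def packingEleven : List Quad :=
  develop [(0, 3), (3, 3), (6, 3)] 3
    [⟨0, 1, 3, 10⟩, ⟨0, 1, 4, 9⟩, ⟨0, 1, 7, 8⟩, ⟨0, 3, 5, 7⟩, ⟨0, 3, 6, 8⟩, ⟨0, 4, 5, 8⟩,
     ⟨0, 4, 6, 10⟩, ⟨0, 5, 6, 9⟩, ⟨0, 8, 9, 10⟩, ⟨3, 4, 6, 9⟩, ⟨3, 6, 7, 10⟩] ++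
  [⟨3, 4, 5, 10⟩, ⟨6, 7, 8, 9⟩]

/-- The cycles of an automorphism of `packingFortySeven`. -/
def cyclesFortySeven : List (ℕ × ℕ) :=
  [(0, 12), (12, 12), (24, 6), (30, 6), (36, 4), (40, 4), (44, 3)]

/-- A packing on forty-seven points with a hole formed by the last eleven points. -/
def packingFortySeven : List Quad :=
  develop cyclesFortySeven 12
    [⟨0, 1, 2, 26⟩, ⟨0, 1, 3, 39⟩, ⟨0, 1, 4, 40⟩, ⟨0, 1, 5, 28⟩, ⟨0, 1, 6, 23⟩, ⟨0, 1, 7, 20⟩,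
     ⟨0, 1, 8, 33⟩, ⟨0, 1, 9, 22⟩, ⟨0, 1, 10, 15⟩, ⟨0, 1, 12, 36⟩, ⟨0, 1, 13, 24⟩, ⟨0, 1, 14, 43⟩,
     ⟨0, 1, 16, 35⟩, ⟨0, 1, 17, 18⟩, ⟨0, 1, 19, 31⟩, ⟨0, 1, 21, 34⟩, ⟨0, 1, 27, 45⟩, ⟨0, 1, 29, 41⟩,
     ⟨0, 1, 30, 46⟩, ⟨0, 1, 32, 37⟩, ⟨0, 1, 38, 44⟩, ⟨0, 2, 4, 45⟩, ⟨0, 2, 5, 39⟩, ⟨0, 2, 7, 30⟩,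
     ⟨0, 2, 9, 23⟩, ⟨0, 2, 13, 19⟩, ⟨0, 2, 14, 16⟩, ⟨0, 2, 15, 32⟩, ⟨0, 2, 18, 44⟩, ⟨0, 2, 20, 22⟩,
     ⟨0, 2, 21, 28⟩, ⟨0, 2, 24, 33⟩, ⟨0, 2, 25, 37⟩, ⟨0, 2, 27, 41⟩, ⟨0, 2, 29, 34⟩, ⟨0, 2, 31, 40⟩,
     ⟨0, 2, 35, 36⟩, ⟨0, 2, 42, 43⟩, ⟨0, 3, 6, 21⟩, ⟨0, 3, 7, 22⟩, ⟨0, 3, 8, 41⟩, ⟨0, 3, 12, 19⟩,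
     ⟨0, 3, 15, 16⟩, ⟨0, 3, 20, 27⟩, ⟨0, 3, 23, 34⟩, ⟨0, 3, 24, 31⟩, ⟨0, 3, 25, 32⟩, ⟨0, 3, 26, 33⟩,
     ⟨0, 3, 28, 30⟩, ⟨0, 3, 29, 35⟩, ⟨0, 3, 36, 45⟩, ⟨0, 3, 40, 46⟩, ⟨0, 3, 42, 44⟩, ⟨0, 4, 12, 20⟩,
     ⟨0, 4, 14, 18⟩, ⟨0, 4, 15, 43⟩, ⟨0, 4, 16, 46⟩, ⟨0, 4, 17, 36⟩, ⟨0, 4, 21, 42⟩, ⟨0, 4, 22, 44⟩,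
     ⟨0, 4, 23, 37⟩, ⟨0, 4, 24, 29⟩, ⟨0, 4, 25, 28⟩, ⟨0, 4, 26, 38⟩, ⟨0, 4, 30, 39⟩, ⟨0, 4, 32, 35⟩,
     ⟨0, 4, 33, 34⟩, ⟨0, 5, 12, 33⟩, ⟨0, 5, 16, 23⟩, ⟨0, 5, 17, 38⟩, ⟨0, 5, 18, 26⟩, ⟨0, 5, 19, 43⟩,
     ⟨0, 5, 20, 29⟩, ⟨0, 5, 21, 24⟩, ⟨0, 5, 25, 45⟩, ⟨0, 5, 27, 37⟩, ⟨0, 5, 30, 44⟩, ⟨0, 5, 32, 41⟩,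
     ⟨0, 5, 36, 46⟩, ⟨0, 6, 36, 43⟩, ⟨0, 6, 37, 42⟩, ⟨0, 12, 15, 17⟩, ⟨0, 12, 16, 44⟩,
     ⟨0, 12, 21, 23⟩, ⟨0, 12, 22, 46⟩, ⟨0, 12, 24, 38⟩, ⟨0, 12, 25, 30⟩, ⟨0, 12, 26, 35⟩,
     ⟨0, 12, 27, 28⟩, ⟨0, 12, 31, 32⟩, ⟨0, 12, 34, 39⟩, ⟨0, 12, 40, 43⟩, ⟨0, 12, 41, 42⟩,
     ⟨0, 13, 14, 17⟩, ⟨0, 13, 15, 37⟩, ⟨0, 13, 16, 38⟩, ⟨0, 13, 18, 21⟩, ⟨0, 13, 20, 26⟩,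
     ⟨0, 13, 22, 43⟩, ⟨0, 13, 23, 40⟩, ⟨0, 13, 25, 41⟩, ⟨0, 13, 28, 34⟩, ⟨0, 13, 29, 46⟩,
     ⟨0, 13, 31, 39⟩, ⟨0, 13, 32, 44⟩, ⟨0, 13, 33, 45⟩, ⟨0, 14, 15, 21⟩, ⟨0, 14, 19, 23⟩,
     ⟨0, 14, 24, 26⟩, ⟨0, 14, 25, 40⟩, ⟨0, 14, 27, 33⟩, ⟨0, 14, 28, 32⟩, ⟨0, 14, 29, 31⟩,
     ⟨0, 14, 30, 34⟩, ⟨0, 14, 35, 41⟩, ⟨0, 14, 36, 37⟩, ⟨0, 14, 38, 39⟩, ⟨0, 14, 44, 45⟩,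
     ⟨0, 15, 18, 19⟩, ⟨0, 15, 20, 28⟩, ⟨0, 15, 22, 35⟩, ⟨0, 15, 23, 30⟩, ⟨0, 15, 25, 38⟩,
     ⟨0, 15, 26, 40⟩, ⟨0, 15, 27, 46⟩, ⟨0, 15, 29, 42⟩, ⟨0, 15, 31, 44⟩, ⟨0, 15, 36, 41⟩,
     ⟨0, 15, 39, 45⟩, ⟨0, 16, 19, 39⟩, ⟨0, 16, 24, 30⟩, ⟨0, 16, 26, 34⟩, ⟨0, 16, 27, 36⟩,
     ⟨0, 16, 28, 33⟩, ⟨0, 16, 29, 32⟩, ⟨0, 16, 31, 37⟩, ⟨0, 16, 40, 42⟩, ⟨0, 16, 41, 43⟩,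
     ⟨0, 17, 19, 41⟩, ⟨0, 17, 20, 34⟩, ⟨0, 17, 21, 26⟩, ⟨0, 17, 22, 40⟩, ⟨0, 17, 25, 44⟩,
     ⟨0, 17, 28, 29⟩, ⟨0, 17, 30, 37⟩, ⟨0, 17, 31, 43⟩, ⟨0, 17, 32, 45⟩, ⟨0, 17, 33, 39⟩,
     ⟨0, 17, 35, 46⟩, ⟨0, 18, 22, 45⟩, ⟨0, 18, 24, 41⟩, ⟨0, 18, 25, 29⟩, ⟨0, 18, 27, 31⟩,
     ⟨0, 18, 28, 43⟩, ⟨0, 18, 32, 42⟩, ⟨0, 18, 33, 35⟩, ⟨0, 18, 34, 40⟩, ⟨0, 18, 36, 39⟩,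
     ⟨0, 18, 37, 38⟩, ⟨0, 19, 20, 30⟩, ⟨0, 19, 21, 36⟩, ⟨0, 19, 22, 42⟩, ⟨0, 19, 24, 32⟩,
     ⟨0, 19, 27, 38⟩, ⟨0, 19, 28, 44⟩, ⟨0, 19, 29, 45⟩, ⟨0, 19, 33, 46⟩, ⟨0, 19, 35, 40⟩,
     ⟨0, 20, 21, 32⟩, ⟨0, 20, 23, 24⟩, ⟨0, 20, 25, 35⟩, ⟨0, 20, 36, 40⟩, ⟨0, 20, 37, 41⟩,
     ⟨0, 20, 38, 42⟩, ⟨0, 20, 39, 43⟩, ⟨0, 20, 44, 46⟩, ⟨0, 21, 22, 25⟩, ⟨0, 21, 27, 44⟩,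
     ⟨0, 21, 30, 41⟩, ⟨0, 21, 31, 46⟩, ⟨0, 21, 33, 43⟩, ⟨0, 21, 35, 39⟩, ⟨0, 21, 37, 40⟩,
     ⟨0, 21, 38, 45⟩, ⟨0, 22, 23, 41⟩, ⟨0, 22, 24, 28⟩, ⟨0, 22, 26, 31⟩, ⟨0, 22, 27, 30⟩,
     ⟨0, 22, 29, 33⟩, ⟨0, 22, 32, 34⟩, ⟨0, 22, 36, 38⟩, ⟨0, 22, 37, 39⟩, ⟨0, 23, 25, 46⟩,
     ⟨0, 23, 26, 36⟩, ⟨0, 23, 27, 42⟩, ⟨0, 23, 28, 45⟩, ⟨0, 23, 29, 38⟩, ⟨0, 23, 32, 33⟩,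
     ⟨0, 23, 35, 44⟩, ⟨0, 24, 25, 42⟩, ⟨0, 24, 35, 37⟩, ⟨0, 24, 39, 46⟩, ⟨0, 24, 40, 44⟩,
     ⟨0, 24, 43, 45⟩, ⟨0, 25, 27, 39⟩, ⟨0, 25, 34, 36⟩, ⟨0, 26, 27, 43⟩, ⟨0, 26, 28, 37⟩,
     ⟨0, 26, 39, 42⟩, ⟨0, 26, 41, 45⟩, ⟨0, 27, 29, 40⟩, ⟨0, 28, 39, 41⟩, ⟨0, 28, 42, 46⟩,
     ⟨0, 29, 36, 44⟩, ⟨0, 29, 37, 43⟩, ⟨0, 30, 31, 42⟩, ⟨0, 30, 32, 36⟩, ⟨0, 30, 38, 43⟩,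
     ⟨0, 30, 40, 45⟩, ⟨0, 31, 33, 41⟩, ⟨0, 31, 35, 38⟩, ⟨0, 32, 38, 40⟩, ⟨0, 32, 43, 46⟩,
     ⟨0, 33, 36, 42⟩, ⟨0, 33, 37, 44⟩, ⟨0, 34, 35, 43⟩, ⟨0, 34, 38, 46⟩, ⟨0, 34, 41, 44⟩,
     ⟨0, 34, 42, 45⟩, ⟨12, 13, 14, 26⟩, ⟨12, 13, 15, 24⟩, ⟨12, 13, 17, 36⟩, ⟨12, 13, 20, 38⟩,
     ⟨12, 13, 27, 41⟩, ⟨12, 13, 29, 37⟩, ⟨12, 13, 31, 33⟩, ⟨12, 13, 32, 46⟩, ⟨12, 13, 34, 45⟩,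
     ⟨12, 13, 39, 40⟩, ⟨12, 13, 42, 44⟩, ⟨12, 14, 16, 46⟩, ⟨12, 14, 17, 33⟩, ⟨12, 14, 19, 30⟩,
     ⟨12, 14, 24, 34⟩, ⟨12, 14, 25, 28⟩, ⟨12, 14, 27, 38⟩, ⟨12, 14, 31, 39⟩, ⟨12, 14, 32, 35⟩,
     ⟨12, 14, 42, 43⟩, ⟨12, 15, 25, 32⟩, ⟨12, 15, 26, 33⟩, ⟨12, 15, 27, 30⟩, ⟨12, 15, 29, 34⟩,
     ⟨12, 15, 38, 44⟩, ⟨12, 15, 40, 45⟩, ⟨12, 15, 42, 46⟩, ⟨12, 16, 24, 25⟩, ⟨12, 16, 26, 42⟩,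
     ⟨12, 16, 28, 37⟩, ⟨12, 16, 29, 40⟩, ⟨12, 16, 30, 43⟩, ⟨12, 16, 32, 36⟩, ⟨12, 16, 33, 41⟩,
     ⟨12, 16, 34, 35⟩, ⟨12, 17, 26, 28⟩, ⟨12, 17, 27, 45⟩, ⟨12, 17, 29, 44⟩, ⟨12, 17, 30, 41⟩,
     ⟨12, 17, 32, 37⟩, ⟨12, 17, 39, 42⟩, ⟨12, 17, 40, 46⟩, ⟨12, 18, 36, 42⟩, ⟨12, 18, 37, 43⟩,
     ⟨12, 24, 27, 42⟩, ⟨12, 24, 30, 36⟩, ⟨12, 24, 32, 41⟩, ⟨12, 25, 27, 43⟩, ⟨12, 25, 33, 39⟩,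
     ⟨12, 25, 37, 46⟩, ⟨12, 25, 41, 44⟩, ⟨12, 25, 42, 45⟩, ⟨12, 26, 34, 37⟩, ⟨12, 26, 36, 41⟩,
     ⟨12, 26, 38, 46⟩, ⟨12, 27, 32, 39⟩, ⟨12, 27, 36, 44⟩, ⟨12, 28, 31, 38⟩, ⟨12, 28, 34, 40⟩,
     ⟨12, 29, 35, 38⟩, ⟨12, 29, 39, 45⟩, ⟨12, 30, 37, 40⟩, ⟨12, 30, 39, 46⟩, ⟨12, 31, 34, 43⟩,
     ⟨12, 31, 35, 42⟩, ⟨12, 31, 37, 44⟩, ⟨12, 33, 38, 45⟩, ⟨12, 35, 36, 46⟩, ⟨12, 35, 40, 44⟩,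
     ⟨12, 35, 43, 45⟩, ⟨24, 25, 36, 39⟩, ⟨24, 31, 36, 40⟩, ⟨24, 31, 37, 41⟩, ⟨24, 33, 40, 41⟩,
     ⟨24, 34, 36, 43⟩, ⟨24, 34, 37, 42⟩, ⟨24, 35, 40, 43⟩, ⟨30, 31, 36, 39⟩] ++
  develop cyclesFortySeven 6
    [⟨0, 2, 6, 8⟩, ⟨0, 6, 12, 18⟩, ⟨0, 6, 14, 20⟩, ⟨0, 6, 16, 22⟩, ⟨0, 6, 24, 34⟩, ⟨0, 6, 25, 31⟩,
     ⟨0, 6, 26, 29⟩, ⟨0, 6, 27, 35⟩, ⟨0, 6, 30, 33⟩, ⟨0, 6, 45, 46⟩, ⟨12, 14, 18, 20⟩,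
     ⟨12, 18, 24, 31⟩, ⟨12, 18, 25, 26⟩, ⟨12, 18, 27, 34⟩, ⟨12, 18, 28, 29⟩, ⟨12, 18, 30, 35⟩,
     ⟨12, 18, 32, 33⟩, ⟨12, 18, 44, 46⟩, ⟨24, 25, 26, 46⟩, ⟨24, 25, 30, 44⟩, ⟨24, 25, 31, 32⟩,
     ⟨24, 25, 34, 35⟩, ⟨24, 26, 30, 34⟩, ⟨24, 26, 31, 33⟩, ⟨24, 26, 32, 44⟩, ⟨24, 26, 35, 45⟩,
     ⟨24, 27, 36, 38⟩, ⟨24, 30, 32, 46⟩, ⟨24, 30, 41, 43⟩, ⟨24, 31, 44, 46⟩, ⟨24, 32, 33, 45⟩,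
     ⟨24, 32, 40, 42⟩, ⟨24, 33, 35, 44⟩, ⟨24, 34, 45, 46⟩, ⟨30, 31, 32, 45⟩, ⟨30, 33, 36, 38⟩] ++
  develop cyclesFortySeven 3
    [⟨12, 15, 18, 21⟩, ⟨24, 25, 27, 28⟩, ⟨24, 27, 30, 33⟩, ⟨24, 27, 31, 34⟩, ⟨24, 27, 32, 35⟩,
     ⟨24, 27, 44, 45⟩, ⟨30, 31, 33, 34⟩, ⟨30, 33, 44, 46⟩]

/-- The cycles of an automorphism of `packingThirtyFive`. -/
def cyclesThirtyFive : List (ℕ × ℕ) :=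
  [(0, 24), (24, 4), (28, 4), (32, 3)]

/-- A packing on thirty-five points with a hole formed by the last eleven points. -/
def packingThirtyFive : List Quad :=
  develop cyclesThirtyFive 24
    [⟨0, 1, 2, 33⟩, ⟨0, 1, 3, 16⟩, ⟨0, 1, 4, 22⟩, ⟨0, 1, 5, 26⟩, ⟨0, 1, 6, 21⟩, ⟨0, 1, 7, 12⟩,
     ⟨0, 1, 8, 29⟩, ⟨0, 1, 9, 31⟩, ⟨0, 1, 10, 11⟩, ⟨0, 1, 13, 18⟩, ⟨0, 1, 17, 28⟩, ⟨0, 1, 19, 34⟩,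
     ⟨0, 1, 20, 30⟩, ⟨0, 1, 24, 27⟩, ⟨0, 2, 4, 11⟩, ⟨0, 2, 5, 7⟩, ⟨0, 2, 8, 28⟩, ⟨0, 2, 10, 17⟩,
     ⟨0, 2, 12, 18⟩, ⟨0, 2, 13, 16⟩, ⟨0, 2, 20, 31⟩, ⟨0, 2, 24, 34⟩, ⟨0, 2, 25, 32⟩, ⟨0, 2, 26, 30⟩,
     ⟨0, 2, 27, 29⟩, ⟨0, 3, 7, 25⟩, ⟨0, 3, 8, 17⟩, ⟨0, 3, 10, 14⟩, ⟨0, 3, 18, 32⟩, ⟨0, 3, 19, 24⟩,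
     ⟨0, 3, 20, 27⟩, ⟨0, 3, 28, 34⟩, ⟨0, 3, 29, 31⟩, ⟨0, 3, 30, 33⟩, ⟨0, 4, 8, 33⟩, ⟨0, 4, 10, 19⟩,
     ⟨0, 4, 13, 28⟩, ⟨0, 4, 15, 29⟩, ⟨0, 4, 18, 24⟩, ⟨0, 5, 10, 34⟩, ⟨0, 5, 13, 27⟩, ⟨0, 5, 16, 24⟩,
     ⟨0, 5, 28, 29⟩, ⟨0, 6, 13, 34⟩, ⟨0, 6, 16, 27⟩, ⟨0, 6, 24, 29⟩, ⟨0, 6, 25, 28⟩, ⟨0, 7, 24, 32⟩,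
     ⟨0, 7, 26, 33⟩, ⟨0, 7, 29, 30⟩, ⟨0, 8, 32, 34⟩, ⟨0, 9, 24, 26⟩, ⟨0, 9, 25, 33⟩, ⟨0, 9, 27, 34⟩,
     ⟨0, 10, 24, 30⟩, ⟨0, 10, 27, 31⟩, ⟨0, 10, 28, 33⟩, ⟨0, 10, 29, 32⟩, ⟨0, 11, 24, 25⟩,
     ⟨0, 11, 28, 32⟩, ⟨0, 11, 30, 34⟩] ++
  develop cyclesThirtyFive 12
    [⟨0, 3, 12, 15⟩, ⟨0, 4, 12, 16⟩, ⟨0, 12, 24, 31⟩, ⟨0, 12, 25, 30⟩, ⟨0, 12, 26, 29⟩,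
     ⟨0, 12, 27, 28⟩, ⟨0, 12, 33, 34⟩]

/-- The triples in the blocks of `L`. -/
def triples (L : List Quad) : List (ℕ × ℕ × ℕ) :=
  L.flatMap Quad.triples

/-- The blocks in `L` are increasing, have points below `v`, and share no triples. -/
def Packs (v : ℕ) (L : List Quad) : Prop :=
  (∀ q ∈ L, q.a < q.b ∧ q.b < q.c ∧ q.c < q.d ∧ q.d < v) ∧ (triples L).Nodup

/-- The image of a triple under a map of points. -/
def mapTriple (f : ℕ → ℕ) (t : ℕ × ℕ × ℕ) : ℕ × ℕ × ℕ :=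
  (f t.1, f t.2.1, f t.2.2)

/-- Whether the blocks in `L` are increasing, have points below `v`, satisfy `p`, and have triples
that are pairwise distinct and not in the set of triples with binary encoding `m`. -/
def checkPacks (v : ℕ) (p : Quad → Bool) : List Quad → ℕ → Bool
  | [], _ => true
  | ⟨a, b, c, d⟩ :: L, m =>
    Nat.blt a b && Nat.blt b c && Nat.blt c d && Nat.blt d v && p ⟨a, b, c, d⟩ &&
    (let n := Nat.lor (Nat.lor (2 ^ ((a * v + b) * v + c)) (2 ^ ((a * v + b) * v + d)))
        (Nat.lor (2 ^ ((a * v + c) * v + d)) (2 ^ ((b * v + c) * v + d)))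
    Nat.beq (Nat.land m n) 0 && checkPacks v p L (Nat.lor m n))

theorem mem_triples {L : List Quad} {t : ℕ × ℕ × ℕ} :
    t ∈ triples L ↔ ∃ q ∈ L, t ∈ q.triples := by
  simp [triples]

theorem Quad.mem_triples {q : Quad} {t : ℕ × ℕ × ℕ} :
    t ∈ q.triples ↔ t = (q.a, q.b, q.c) ∨ t = (q.a, q.b, q.d) ∨ t = (q.a, q.c, q.d) ∨
      t = (q.b, q.c, q.d) := by
  simp [Quad.triples]

theorem triples_append (A B : List Quad) : triples (A ++ B) = triples A ++ triples B := by
  simp [triples]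

theorem triples_flatMap {ι : Type*} (I : List ι) (P : ι → List Quad) :
    triples (I.flatMap P) = I.flatMap fun i => triples (P i) := by
  simp [triples, List.flatMap_assoc]

theorem triples_mapQuads (f : ℕ → ℕ) (L : List Quad) :
    triples (mapQuads f L) = (triples L).map (mapTriple f) := by
  simp [triples, mapQuads, List.map_flatMap, List.flatMap_map, Quad.triples, mapTriple]

theorem Packs.lt {v : ℕ} {L : List Quad} (h : Packs v L) {t : ℕ × ℕ × ℕ} (ht : t ∈ triples L) :
    t.1 < t.2.1 ∧ t.2.1 < t.2.2 ∧ t.2.2 < v := by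
  obtain ⟨q, hq, ht⟩ := mem_triples.1 ht
  have := h.1 q hq
  rw [Quad.mem_triples] at ht
  rcases ht with rfl | rfl | rfl | rfl <;> dsimp only <;> omega

theorem Packs.append {v : ℕ} {A B : List Quad} (hA : Packs v A) (hB : Packs v B)
    (h : ∀ t ∈ triples A, t ∉ triples B) : Packs v (A ++ B) := by
  refine ⟨fun q hq => (List.mem_append.1 hq).elim (hA.1 q) (hB.1 q), ?_⟩
  rw [triples_append, List.nodup_append]
  exact ⟨hA.2, hB.2, fun a ha b hb hab => h a ha (hab ▸ hb)⟩

theorem Packs.mono {v w : ℕ} {L : List Quad} (h : Packs v L) (hw : v ≤ w) : Packs w L :=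
  ⟨fun q hq => by have := h.1 q hq; omega, h.2⟩

theorem Packs.mapQuads {v w : ℕ} {L : List Quad} (h : Packs v L) {f : ℕ → ℕ}
    (hf : ∀ x y, x < y → y < v → f x < f y) (hw : ∀ x < v, f x < w) :
    Packs w (mapQuads f L) := by
  refine ⟨fun q hq => ?_, ?_⟩
  · simp only [_root_.mapQuads, List.mem_map] at hq
    obtain ⟨r, hr, rfl⟩ := hq
    have := h.1 r hr
    exact ⟨hf _ _ this.1 (by omega), hf _ _ this.2.1 (by omega), hf _ _ this.2.2.1 this.2.2.2,
      hw _ this.2.2.2⟩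
  · have inj : ∀ x < v, ∀ y < v, f x = f y → x = y := fun x hx y hy hxy => by
      rcases lt_trichotomy x y with hlt | hlt | hlt
      · exact absurd (hf x y hlt hy) (by omega)
      · exact hlt
      · exact absurd (hf y x hlt hx) (by omega)
    rw [triples_mapQuads]
    refine h.2.map_on fun s hs t ht hst => ?_
    have h₁ := h.lt hs
    have h₂ := h.lt ht
    simp only [mapTriple, Prod.mk.injEq] at hst
    exact Prod.ext (inj _ (by omega) _ (by omega) hst.1) (Prod.ext
      (inj _ (by omega) _ (by omega) hst.2.1) (inj _ (by omega) _ (by omega) hst.2.2))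

/-- Lists whose elements have labels from lists without common elements have no common elements. -/
theorem nodup_flatMap_of_label {ι α β : Type*} {I : List ι} {g : ι → List β} {h : ι → List α}
    (hg : (I.flatMap g).Nodup) (hne : ∀ i ∈ I, (h i).Nodup) (κ : α → β)
    (hκ : ∀ i ∈ I, ∀ t ∈ h i, κ t ∈ g i) : (I.flatMap h).Nodup := by
  rw [List.nodup_flatMap] at hg ⊢
  refine ⟨hne, hg.2.imp_of_mem fun {a b} ha hb hab t hta htb => ?_⟩
  exact hab (hκ a ha t hta) (hκ b hb t htb)

theorem lift_div {m : ℕ} (hm : 0 < m) (f : ℕ → ℕ) (y : ℕ) : lift m f y / m = f (y / m) := by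
  rw [lift, Nat.mul_add_div hm, Nat.div_eq_of_lt (Nat.mod_lt _ hm), add_zero]

theorem lift_lt_lift {m : ℕ} (hm : 0 < m) {f : ℕ → ℕ} {x y : ℕ} (hxy : x < y)
    (hf : x / m < y / m → f (x / m) < f (y / m)) : lift m f x < lift m f y := by
  rcases (Nat.div_le_div_right hxy.le : x / m ≤ y / m).lt_or_eq with h | h
  · exact Nat.lt_of_div_lt_div (by rw [lift_div hm, lift_div hm]; exact hf h)
  · have hx := Nat.div_add_mod x m
    have hy := Nat.div_add_mod y m
    rw [lift, lift, h]
    rw [h] at hx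
    omega

/-- The map on triples of cells induced by lifting a map of cells. -/
theorem mapTriple_lift {m : ℕ} (hm : 0 < m) (f : ℕ → ℕ) (t : ℕ × ℕ × ℕ) :
    mapTriple (· / m) (mapTriple (lift m f) t) = mapTriple f (mapTriple (· / m) t) := by
  simp [mapTriple, lift_div hm]

theorem Packs.mapQuads_lift {m k v : ℕ} (hm : 0 < m) {L : List Quad} (h : Packs (m * k) L)
    {f : ℕ → ℕ} (hf : ∀ i j, i < j → j < k → f i < f j) (hv : ∀ i < k, f i < v) :
    Packs (m * v) (_root_.mapQuads (lift m f) L) := by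
  refine h.mapQuads (fun x y hxy hy => lift_lt_lift hm hxy fun hlt => hf _ _ hlt ?_)
    fun x hx => ?_
  · exact Nat.div_lt_of_lt_mul hy
  · rw [mul_comm, ← Nat.div_lt_iff_lt_mul hm, lift_div hm]
    exact hv _ (Nat.div_lt_of_lt_mul hx)

theorem packs_of_checkPacks {v : ℕ} {p : Quad → Bool} {L : List Quad}
    (h : checkPacks v p L 0 = true) : Packs v L ∧ ∀ q ∈ L, p q = true := by
  suffices H : ∀ (L : List Quad) (m : ℕ), checkPacks v p L m = true →
      Packs v L ∧ (∀ q ∈ L, p q = true) ∧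
        ∀ t ∈ triples L, m.testBit ((t.1 * v + t.2.1) * v + t.2.2) = false from
    ⟨(H L 0 h).1, (H L 0 h).2.1⟩
  intro L
  induction L with
  | nil => intro m _; simp [Packs, triples]
  | cons q L ih =>
    intro m h
    obtain ⟨a, b, c, d⟩ := q
    simp only [checkPacks, Bool.and_eq_true, Nat.blt_eq] at h
    obtain ⟨⟨⟨⟨⟨hab, hbc⟩, hcd⟩, hdv⟩, hp⟩, hn, hL⟩ := h
    obtain ⟨hP, hpL, hbits⟩ := ih _ hL
    set n := Nat.lor (Nat.lor (2 ^ ((a * v + b) * v + c)) (2 ^ ((a * v + b) * v + d)))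
        (Nat.lor (2 ^ ((a * v + c) * v + d)) (2 ^ ((b * v + c) * v + d))) with hn_def
    have hnq : ∀ t ∈ Quad.triples ⟨a, b, c, d⟩,
        n.testBit ((t.1 * v + t.2.1) * v + t.2.2) = true := by
      intro t ht
      have e : n = ((2 ^ ((a * v + b) * v + c)) ||| (2 ^ ((a * v + b) * v + d))) |||
        ((2 ^ ((a * v + c) * v + d)) ||| (2 ^ ((b * v + c) * v + d))) := rfl
      rw [e]
      rw [Quad.mem_triples] at ht
      rcases ht with rfl | rfl | rfl | rfl <;> simp [Nat.testBit_or, Nat.testBit_two_pow_self]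
    have hmn : ∀ i, (m.testBit i && n.testBit i) = false := fun i => by
      rw [← Nat.testBit_and]
      change (Nat.land m n).testBit i = false
      rw [Nat.eq_of_beq_eq_true hn, Nat.zero_testBit]
    have hor : ∀ i, (Nat.lor m n).testBit i = (m.testBit i || n.testBit i) :=
      fun i => Nat.testBit_or m n i
    refine ⟨⟨?_, ?_⟩, ?_, ?_⟩
    · rintro q (_ | ⟨_, hq⟩)
      exacts [⟨hab, hbc, hcd, hdv⟩, hP.1 q hq]
    · change (Quad.triples ⟨a, b, c, d⟩ ++ triples L).Nodup
      rw [List.nodup_append]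
      refine ⟨?_, hP.2, ?_⟩
      · simp [Quad.triples]
        omega
      · rintro s hs t ht rfl
        have := hbits s ht
        rw [hor, hnq s hs] at this
        simp at this
    · rintro q (_ | ⟨_, hq⟩)
      exacts [hp, hpL q hq]
    · intro t ht
      change t ∈ Quad.triples ⟨a, b, c, d⟩ ++ triples L at ht
      rcases List.mem_append.1 ht with ht | ht
      · have := hmn ((t.1 * v + t.2.1) * v + t.2.2)
        rwa [hnq t ht, Bool.and_true] at this
      · have := hbits t ht
        rw [hor, Bool.or_eq_false_iff] at this
        exact this.1

theorem Quad.get_lt {q : Quad} (h : q.a < q.b ∧ q.b < q.c ∧ q.c < q.d) {i j : ℕ} (hij : i < j)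
    (hj : j < 4) : q.get i < q.get j := by
  interval_cases j <;> interval_cases i <;> simp only [Quad.get] <;> omega

theorem inflate_triple {m : ℕ} (hm : 0 < m) {P : List Quad}
    (hP : ∀ q ∈ P, q.a / m = 0 ∧ q.b / m = 1 ∧ q.c / m = 2 ∧ q.d / m = 3) (q : Quad)
    {t : ℕ × ℕ × ℕ} (ht : t ∈ triples (mapQuads (lift m q.get) P)) :
    mapTriple (· / m) t ∈ q.triples := by
  rw [triples_mapQuads, List.mem_map] at ht
  obtain ⟨u, hu, rfl⟩ := ht
  obtain ⟨r, hr, hu⟩ := mem_triples.1 hu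
  obtain ⟨h₀, h₁, h₂, h₃⟩ := hP r hr
  rw [mapTriple_lift hm]
  rw [Quad.mem_triples] at hu
  rcases hu with rfl | rfl | rfl | rfl <;> simp [mapTriple, h₀, h₁, h₂, h₃, Quad.get, Quad.triples]

theorem Packs.inflate {m v : ℕ} (hm : 0 < m) {P L : List Quad} (hP : Packs (m * 4) P)
    (hP' : ∀ q ∈ P, q.a / m = 0 ∧ q.b / m = 1 ∧ q.c / m = 2 ∧ q.d / m = 3) (hL : Packs v L) :
    Packs (m * v) (inflate m P L) := by
  have key : ∀ q ∈ L, Packs (m * v) (_root_.mapQuads (lift m q.get) P) := fun q hq => by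
    have hq := hL.1 q hq
    refine hP.mapQuads_lift hm (fun i j hij hj => Quad.get_lt ⟨hq.1, hq.2.1, hq.2.2.1⟩ hij hj)
      fun i hi => ?_
    interval_cases i <;> simp only [Quad.get] <;> omega
  refine ⟨fun r hr => ?_, ?_⟩
  · obtain ⟨q, hq, hr⟩ := List.mem_flatMap.1 hr
    exact (key q hq).1 r hr
  · rw [_root_.inflate, triples_flatMap]
    exact nodup_flatMap_of_label hL.2 (fun q hq => (key q hq).2) (mapTriple (· / m))
      fun q _ t ht => inflate_triple hm hP' q ht

theorem mapTriple_mem_of_mem_inflate {m : ℕ} (hm : 0 < m) {P L : List Quad}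
    (hP : ∀ q ∈ P, q.a / m = 0 ∧ q.b / m = 1 ∧ q.c / m = 2 ∧ q.d / m = 3)
    {t : ℕ × ℕ × ℕ} (ht : t ∈ triples (inflate m P L)) : mapTriple (· / m) t ∈ triples L := by
  rw [_root_.inflate, triples_flatMap] at ht
  obtain ⟨q, hq, ht⟩ := List.mem_flatMap.1 ht
  exact mem_triples.2 ⟨q, hq, inflate_triple hm hP q ht⟩

theorem inflatePairs_triple {m : ℕ} (hm : 0 < m) {P : List Quad}
    (hP : ∀ q ∈ P, q.a / m = 0 ∧ q.b / m = 0 ∧ q.c / m = 1 ∧ q.d / m = 1) (p : ℕ × ℕ)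
    {t : ℕ × ℕ × ℕ}
    (ht : t ∈ triples (mapQuads (lift m fun i => if i = 0 then p.1 else p.2) P)) :
    (t.1 / m, t.2.2 / m) = p ∧ (t.2.1 / m = t.1 / m ∨ t.2.1 / m = t.2.2 / m) := by
  rw [triples_mapQuads, List.mem_map] at ht
  obtain ⟨u, hu, rfl⟩ := ht
  obtain ⟨r, hr, hu⟩ := mem_triples.1 hu
  obtain ⟨h₀, h₁, h₂, h₃⟩ := hP r hr
  rw [Quad.mem_triples] at hu
  rcases hu with rfl | rfl | rfl | rfl <;> simp [mapTriple, lift_div hm, h₀, h₁, h₂, h₃]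

theorem Packs.inflatePairs {m v : ℕ} (hm : 0 < m) {P : List Quad} {L : List (ℕ × ℕ)}
    (hP : Packs (m * 2) P)
    (hP' : ∀ q ∈ P, q.a / m = 0 ∧ q.b / m = 0 ∧ q.c / m = 1 ∧ q.d / m = 1)
    (hL : L.Nodup) (hL' : ∀ p ∈ L, p.1 < p.2 ∧ p.2 < v) :
    Packs (m * v) (inflatePairs m P L) := by
  have key : ∀ p ∈ L, Packs (m * v)
      (_root_.mapQuads (lift m fun i => if i = 0 then p.1 else p.2) P) := fun p hp => by
    have hp := hL' p hp
    refine hP.mapQuads_lift hm (fun i j hij hj => ?_) fun i hi => ?_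
    · obtain ⟨rfl, rfl⟩ : i = 0 ∧ j = 1 := by omega
      exact hp.1
    · interval_cases i
      exacts [hp.1.trans hp.2, hp.2]
  refine ⟨fun r hr => ?_, ?_⟩
  · obtain ⟨q, hq, hr⟩ := List.mem_flatMap.1 hr
    exact (key q hq).1 r hr
  · rw [_root_.inflatePairs, triples_flatMap]
    refine nodup_flatMap_of_label (g := fun p => [p]) (by simpa using hL)
      (fun q hq => (key q hq).2) (fun t => (t.1 / m, t.2.2 / m)) fun p _ t ht => ?_
    rw [(inflatePairs_triple hm hP' p ht).1]
    exact List.mem_singleton_self p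

theorem mem_of_mem_inflatePairs {m : ℕ} (hm : 0 < m) {P : List Quad} {L : List (ℕ × ℕ)}
    (hP : ∀ q ∈ P, q.a / m = 0 ∧ q.b / m = 0 ∧ q.c / m = 1 ∧ q.d / m = 1)
    {t : ℕ × ℕ × ℕ} (ht : t ∈ triples (inflatePairs m P L)) :
    (t.1 / m, t.2.2 / m) ∈ L ∧ (t.2.1 / m = t.1 / m ∨ t.2.1 / m = t.2.2 / m) := by
  rw [_root_.inflatePairs, triples_flatMap] at ht
  obtain ⟨p, hp, ht⟩ := List.mem_flatMap.1 ht
  have := inflatePairs_triple hm hP p ht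
  exact ⟨this.1 ▸ hp, this.2⟩

theorem length_inflate (m : ℕ) (P L : List Quad) :
    (inflate m P L).length = L.length * P.length := by
  simp [inflate, List.length_flatMap, mapQuads, List.map_const', List.sum_replicate]

theorem length_inflatePairs (m : ℕ) (P : List Quad) (L : List (ℕ × ℕ)) :
    (inflatePairs m P L).length = L.length * P.length := by
  simp [inflatePairs, List.length_flatMap, mapQuads, List.map_const', List.sum_replicate]

theorem length_mapQuads (f : ℕ → ℕ) (L : List Quad) : (mapQuads f L).length = L.length := by
  simp [mapQuads]

theorem countP_inflate {m : ℕ} (hm : 0 < m) {P : List Quad} (L : List Quad)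
    (hP : ∀ q ∈ P, q.d / m = 3) (s : ℕ) {r : ℕ} (hr : r < m) :
    (inflate m P L).countP (fun q => Nat.beq q.d (m * s + r)) =
      L.countP (fun q => Nat.beq q.d s) * P.countP (fun q => Nat.beq q.d (m * 3 + r)) := by
  induction L with
  | nil => simp [inflate]
  | cons q L ih =>
    have : (inflate m P (q :: L)) = mapQuads (lift m q.get) P ++ inflate m P L := rfl
    rw [this, List.countP_append, ih, List.countP_cons, add_mul, add_comm]
    congr 1
    rw [mapQuads, List.countP_map]
    by_cases h : q.d = s
    · simp only [h, Nat.beq_refl, if_true, one_mul]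
      refine List.countP_congr fun u hu => ?_
      have h3 := hP u hu
      have := Nat.div_add_mod u.d m
      simp only [Function.comp, Nat.beq_eq, lift, h3, Quad.get, h]
      rw [h3] at this
      omega
    · have h' : Nat.beq q.d s = false := by
        rw [← Bool.not_eq_true, Nat.beq_eq]; exact h
      simp only [h', Bool.false_eq_true, if_false, zero_mul]
      rw [List.countP_eq_zero]
      intro u hu
      simp only [Function.comp, Nat.beq_eq]
      intro he
      apply h
      have := lift_div hm q.get u.d
      rw [he, hP u hu, Nat.mul_add_div hm, Nat.div_eq_of_lt hr] at this
      simpa [Quad.get] using this.symm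

theorem mem_triples_lift {m : ℕ} (hm : 0 < m) {f : ℕ → ℕ} {L : List Quad} {t : ℕ × ℕ × ℕ}
    (ht : t ∈ triples (mapQuads (lift m f) L)) :
    ∃ u ∈ triples L, t.1 / m = f (u.1 / m) ∧ t.2.1 / m = f (u.2.1 / m) ∧
      t.2.2 / m = f (u.2.2 / m) := by
  rw [triples_mapQuads, List.mem_map] at ht
  obtain ⟨u, hu, rfl⟩ := ht
  exact ⟨u, hu, by simp only [mapTriple, lift_div hm, and_self]⟩

theorem countP_eq_zero_of_triples {L : List Quad} {z : ℕ} (h : ∀ t ∈ triples L, t.2.2 ≠ z) :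
    L.countP (fun q => Nat.beq q.d z) = 0 := by
  rw [List.countP_eq_zero]
  intro q hq
  rw [Nat.beq_eq]
  exact h (q.b, q.c, q.d) (mem_triples.2 ⟨q, hq, Quad.mem_triples.2 (by simp)⟩)

theorem nodup_crossPairs (m s : ℕ) : (crossPairs m s).Nodup :=
  (List.nodup_range.product List.nodup_range).filter _

theorem mem_crossPairs {m s : ℕ} {p : ℕ × ℕ} :
    p ∈ crossPairs m s ↔ p.1 < s ∧ p.2 < s ∧ p.1 / m < p.2 / m := by
  obtain ⟨x, y⟩ := p
  simp [crossPairs, and_assoc]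

theorem lt_of_mem_crossPairs {m s : ℕ} {p : ℕ × ℕ} (hp : p ∈ crossPairs m s) :
    p.1 < p.2 ∧ p.2 < s :=
  ⟨Nat.lt_of_div_lt_div (mem_crossPairs.1 hp).2.2, (mem_crossPairs.1 hp).2.1⟩

theorem transversalTwo_packs : Packs (2 * 4) transversalTwo := by
  refine (packs_of_checkPacks (p := fun _ => true) ?_).1
  decide +kernel

theorem transversalTwo_div :
    ∀ q ∈ transversalTwo, q.a / 2 = 0 ∧ q.b / 2 = 1 ∧ q.c / 2 = 2 ∧ q.d / 2 = 3 := by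
  decide +kernel

theorem transversalSix_packs : Packs (6 * 4) transversalSix := by
  refine (packs_of_checkPacks (p := fun _ => true) ?_).1
  decide +kernel

theorem transversalSix_div :
    ∀ q ∈ transversalSix, q.a / 6 = 0 ∧ q.b / 6 = 1 ∧ q.c / 6 = 2 ∧ q.d / 6 = 3 := by
  decide +kernel

theorem pairsTwo_packs : Packs (2 * 2) [⟨0, 1, 2, 3⟩] := by
  refine (packs_of_checkPacks (p := fun _ => true) ?_).1
  decide +kernel

theorem pairsTwo_div :
    ∀ q ∈ [(⟨0, 1, 2, 3⟩ : Quad)], q.a / 2 = 0 ∧ q.b / 2 = 0 ∧ q.c / 2 = 1 ∧ q.d / 2 = 1 := by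
  decide

theorem pairsSix_packs : Packs (6 * 2) pairsSix := by
  refine (packs_of_checkPacks (p := fun _ => true) ?_).1
  decide +kernel

theorem pairsSix_div :
    ∀ q ∈ pairsSix, q.a / 6 = 0 ∧ q.b / 6 = 0 ∧ q.c / 6 = 1 ∧ q.d / 6 = 1 := by
  decide +kernel

theorem quadsTen_packs : Packs 10 quadsTen := by
  refine (packs_of_checkPacks (p := fun _ => true) ?_).1
  decide +kernel

theorem quadsTwelve_packs : Packs 12 quadsTwelve := by
  refine (packs_of_checkPacks (p := fun _ => true) ?_).1
  decide +kernel

theorem cqsEighteen_packs : Packs 18 cqsEighteen ∧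
    ∀ t ∈ triples cqsEighteen, t.1 / 6 ≠ t.2.2 / 6 := by
  have h : Packs 18 cqsEighteen ∧ ∀ q ∈ cqsEighteen,
      (Nat.blt (q.a / 6) (q.c / 6) && Nat.blt (q.b / 6) (q.d / 6)) = true := by
    refine packs_of_checkPacks ?_
    decide +kernel
  refine ⟨h.1, fun t ht => ?_⟩
  obtain ⟨q, hq, ht⟩ := mem_triples.1 ht
  have h₁ := h.1.1 q hq
  have h₂ := h.2 q hq
  rw [Bool.and_eq_true, Nat.blt_eq, Nat.blt_eq] at h₂
  rw [Quad.mem_triples] at ht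
  rcases ht with rfl | rfl | rfl | rfl <;> dsimp only <;> omega

theorem pairsEighteen_packs : Packs 36 pairsEighteen ∧
    ∀ q ∈ pairsEighteen, q.b < 18 ∧ 18 ≤ q.c ∧ q.c < 30 ∧ (q.a / 6 = q.b / 6 → q.d < 30) := by
  have h : Packs 36 pairsEighteen ∧ ∀ q ∈ pairsEighteen,
      (Nat.blt q.b 18 && Nat.ble 18 q.c && Nat.blt q.c 30 &&
        (Nat.blt (q.a / 6) (q.b / 6) || Nat.blt q.d 30)) = true := by
    refine packs_of_checkPacks ?_
    decide +kernel
  refine ⟨h.1, fun q hq => ?_⟩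
  have h₂ := h.2 q hq
  simp only [Bool.and_eq_true, Bool.or_eq_true, Nat.blt_eq, Nat.ble_eq] at h₂
  omega

/-- The group of a cell when the first `g` cells are in groups of three cells; the stem is
considered as group nine. -/
def group (g c : ℕ) : ℕ :=
  if c < g then c / 3 else 9

/-- Three cells, in increasing order, are not inside the union of a group and the stem. -/
def Cross (g : ℕ) (t : ℕ × ℕ × ℕ) : Prop :=
  ¬((group g t.2.1 = group g t.1 ∨ group g t.2.1 = 9) ∧
    (group g t.2.2 = group g t.1 ∨ group g t.2.2 = 9))

instance (g : ℕ) (t : ℕ × ℕ × ℕ) : Decidable (Cross g t) := by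
  unfold Cross; infer_instance

theorem masterSixty_packs : Packs (6 * 10) masterSixty := by
  refine (Packs.inflate (by norm_num) transversalSix_packs transversalSix_div quadsTen_packs).append
    (pairsSix_packs.inflatePairs (by norm_num) pairsSix_div (nodup_crossPairs 3 9)
      fun p hp => ⟨(lt_of_mem_crossPairs hp).1, (lt_of_mem_crossPairs hp).2.trans (by norm_num)⟩)
    fun t h₁ h₂ => ?_
  have h₁ := quadsTen_packs.lt (mapTriple_mem_of_mem_inflate (by norm_num) transversalSix_div h₁)
  have h₂ := mem_of_mem_inflatePairs (by norm_num) pairsSix_div h₂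
  dsimp only [mapTriple] at h₁
  omega

theorem masterSixty_cross {t : ℕ × ℕ × ℕ} (ht : t ∈ triples masterSixty) :
    Cross 9 (mapTriple (· / 6) t) := by
  rw [masterSixty, triples_append, List.mem_append] at ht
  rcases ht with ht | ht
  · have h : ∀ t ∈ triples quadsTen, Cross 9 t := by decide +kernel
    exact h _ (mapTriple_mem_of_mem_inflate (by norm_num) transversalSix_div ht)
  · obtain ⟨h₁, h₂⟩ := mem_of_mem_inflatePairs (by norm_num) pairsSix_div ht
    rw [mem_crossPairs] at h₁
    simp only [Cross, mapTriple, group] at *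
    grind

theorem length_masterSixty : masterSixty.length = 7047 := by
  rw [masterSixty, List.length_append, length_inflate, length_inflatePairs]
  decide +kernel

theorem countP_masterSixty : masterSixty.countP (fun q => Nat.beq q.d 59) = 324 := by
  have h : (inflatePairs 6 pairsSix (crossPairs 3 9)).countP (fun q => Nat.beq q.d 59) = 0 := by
    refine countP_eq_zero_of_triples fun t ht hd => ?_
    have := (mem_crossPairs.1 (mem_of_mem_inflatePairs (by norm_num) pairsSix_div ht).1).2.1
    simp [hd] at this
  rw [masterSixty, List.countP_append, h,
    countP_inflate (by norm_num) _ (fun q hq => (transversalSix_div q hq).2.2.2) 9 (r := 5)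
      (by norm_num)]
  decide +kernel

/-- Doubling `cqsEighteen` gives blocks on three groups of twelve points. -/
theorem doubleCqsEighteen_packs :
    Packs 36 (inflate 2 transversalTwo cqsEighteen ++
      inflatePairs 2 [⟨0, 1, 2, 3⟩] (crossPairs 6 18)) := by
  refine (Packs.inflate (by norm_num) transversalTwo_packs transversalTwo_div
    cqsEighteen_packs.1).append
    (pairsTwo_packs.inflatePairs (by norm_num) pairsTwo_div (nodup_crossPairs 6 18)
      fun p hp => lt_of_mem_crossPairs hp) fun t h₁ h₂ => ?_
  have h₁ := cqsEighteen_packs.1.lt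
    (mapTriple_mem_of_mem_inflate (by norm_num) transversalTwo_div h₁)
  have h₂ := mem_of_mem_inflatePairs (by norm_num) pairsTwo_div h₂
  dsimp only [mapTriple] at h₁
  omega

theorem doubleCqsEighteen_div {t : ℕ × ℕ × ℕ}
    (ht : t ∈ triples (inflate 2 transversalTwo cqsEighteen ++
      inflatePairs 2 [⟨0, 1, 2, 3⟩] (crossPairs 6 18))) : t.1 / 12 ≠ t.2.2 / 12 := by
  rw [triples_append, List.mem_append] at ht
  rcases ht with ht | ht
  · have := cqsEighteen_packs.2 _
      (mapTriple_mem_of_mem_inflate (by norm_num) transversalTwo_div ht)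
    dsimp only [mapTriple] at this
    omega
  · have := mem_crossPairs.1 (mem_of_mem_inflatePairs (by norm_num) pairsTwo_div ht).1
    dsimp only at this
    omega

theorem pairsTwelve_spec : pairsTwelve.Nodup ∧ ∀ p ∈ pairsTwelve, p.1 < p.2 ∧ p.2 < 11 ∧
    group 11 p.1 ≠ group 11 p.2 ∧ (p.1 % 3 ≠ 0 ∧ p.1 < 9 ↔ ¬(p.2 % 3 ≠ 0 ∧ p.2 < 9)) := by
  unfold group
  decide +kernel

theorem quadsTwelve_spec : ∀ t ∈ triples quadsTwelve, Cross 11 t ∧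
    ¬((t.1 % 3 ≠ 0 ∧ t.1 < 9) ∧ (t.2.1 % 3 ≠ 0 ∧ t.2.1 < 9) ∧ (t.2.2 % 3 ≠ 0 ∧ t.2.2 < 9)) ∧
    ¬(¬(t.1 % 3 ≠ 0 ∧ t.1 < 9) ∧ ¬(t.2.1 % 3 ≠ 0 ∧ t.2.1 < 9) ∧
      ¬(t.2.2 % 3 ≠ 0 ∧ t.2.2 < 9)) := by
  decide +kernel

theorem cellBlocks_packs : Packs (6 * 12)
    (inflate 6 transversalSix quadsTwelve ++ inflatePairs 6 pairsSix pairsTwelve) := by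
  refine (Packs.inflate (by norm_num) transversalSix_packs transversalSix_div
    quadsTwelve_packs).append (pairsSix_packs.inflatePairs (by norm_num) pairsSix_div
      pairsTwelve_spec.1 fun p hp => ?_) fun t h₁ h₂ => ?_
  · have := pairsTwelve_spec.2 p hp
    omega
  · have h₁ := quadsTwelve_packs.lt
      (mapTriple_mem_of_mem_inflate (by norm_num) transversalSix_div h₁)
    have h₂ := mem_of_mem_inflatePairs (by norm_num) pairsSix_div h₂
    dsimp only [mapTriple] at h₁
    omega

theorem cellBlocks_spec {t : ℕ × ℕ × ℕ} (ht : t ∈ triples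
    (inflate 6 transversalSix quadsTwelve ++ inflatePairs 6 pairsSix pairsTwelve)) :
    Cross 11 (mapTriple (· / 6) t) ∧
    ¬((t.1 / 6 % 3 ≠ 0 ∧ t.1 / 6 < 9) ∧ (t.2.1 / 6 % 3 ≠ 0 ∧ t.2.1 / 6 < 9) ∧
      (t.2.2 / 6 % 3 ≠ 0 ∧ t.2.2 / 6 < 9)) ∧
    ¬(¬(t.1 / 6 % 3 ≠ 0 ∧ t.1 / 6 < 9) ∧ ¬(t.2.1 / 6 % 3 ≠ 0 ∧ t.2.1 / 6 < 9) ∧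
      ¬(t.2.2 / 6 % 3 ≠ 0 ∧ t.2.2 / 6 < 9)) := by
  rw [triples_append, List.mem_append] at ht
  rcases ht with ht | ht
  · exact quadsTwelve_spec _ (mapTriple_mem_of_mem_inflate (by norm_num) transversalSix_div ht)
  · obtain ⟨h₁, h₂⟩ := mem_of_mem_inflatePairs (by norm_num) pairsSix_div ht
    obtain ⟨h₃, h₄, h₅, h₆⟩ := pairsTwelve_spec.2 _ h₁
    refine ⟨?_, by tauto, by tauto⟩
    simp only [Cross, mapTriple, group] at *
    grind

theorem doubleBlocks_packs : Packs (6 * 12) (mapQuads (lift 6 fun i => i + 1 + i / 2)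
    (inflate 2 transversalTwo cqsEighteen ++
      inflatePairs 2 [⟨0, 1, 2, 3⟩] (crossPairs 6 18))) :=
  doubleCqsEighteen_packs.mapQuads_lift (k := 6) (by norm_num) (fun _ _ _ _ => by omega)
    fun _ _ => by omega

theorem doubleBlocks_spec {t : ℕ × ℕ × ℕ} (ht : t ∈ triples (mapQuads
    (lift 6 fun i => i + 1 + i / 2) (inflate 2 transversalTwo cqsEighteen ++
      inflatePairs 2 [⟨0, 1, 2, 3⟩] (crossPairs 6 18)))) :
    Cross 11 (mapTriple (· / 6) t) ∧ (t.1 / 6 % 3 ≠ 0 ∧ t.1 / 6 < 9) ∧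
      (t.2.1 / 6 % 3 ≠ 0 ∧ t.2.1 / 6 < 9) ∧ (t.2.2 / 6 % 3 ≠ 0 ∧ t.2.2 / 6 < 9) := by
  obtain ⟨u, hu, h₁, h₂, h₃⟩ := mem_triples_lift (by norm_num) ht
  have h₄ := doubleCqsEighteen_packs.lt hu
  have h₅ := doubleCqsEighteen_div hu
  refine ⟨?_, by omega, by omega, by omega⟩
  simp only [Cross, mapTriple, group, h₁, h₂, h₃]
  grind

theorem cqsBlocks_packs : Packs (6 * 12) (mapQuads (lift 6 fun i => 3 * i) cqsEighteen) :=
  cqsEighteen_packs.1.mapQuads_lift (k := 3) (by norm_num) (fun _ _ _ _ => by omega)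
    fun _ _ => by omega

theorem cqsBlocks_spec {t : ℕ × ℕ × ℕ}
    (ht : t ∈ triples (mapQuads (lift 6 fun i => 3 * i) cqsEighteen)) :
    Cross 11 (mapTriple (· / 6) t) ∧ t.1 / 6 % 3 = 0 ∧ t.2.1 / 6 % 3 = 0 ∧ t.2.2 / 6 % 3 = 0 ∧
      t.2.2 / 6 < 9 := by
  obtain ⟨u, hu, h₁, h₂, h₃⟩ := mem_triples_lift (by norm_num) ht
  have h₄ := cqsEighteen_packs.1.lt hu
  have h₅ := cqsEighteen_packs.2 _ hu
  refine ⟨?_, by omega, by omega, by omega, by omega⟩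
  simp only [Cross, mapTriple, group, h₁, h₂, h₃]
  grind

theorem pairsBlocks_packs :
    Packs (6 * 12) (mapQuads (lift 6 fun i => if i < 3 then 3 * i else i + 6) pairsEighteen) :=
  pairsEighteen_packs.1.mapQuads_lift (k := 6) (by norm_num) (fun _ _ _ _ => by grind)
    fun _ _ => by grind

theorem pairsBlocks_spec {t : ℕ × ℕ × ℕ} (ht : t ∈ triples
    (mapQuads (lift 6 fun i => if i < 3 then 3 * i else i + 6) pairsEighteen)) :
    Cross 11 (mapTriple (· / 6) t) ∧ ¬(t.1 / 6 % 3 ≠ 0 ∧ t.1 / 6 < 9) ∧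
      ¬(t.2.1 / 6 % 3 ≠ 0 ∧ t.2.1 / 6 < 9) ∧ 9 ≤ t.2.2 / 6 := by
  obtain ⟨u, hu, h₁, h₂, h₃⟩ := mem_triples_lift (by norm_num) ht
  obtain ⟨q, hq, hu⟩ := mem_triples.1 hu
  have h₄ := pairsEighteen_packs.1.1 q hq
  have h₅ := pairsEighteen_packs.2 q hq
  rw [Quad.mem_triples] at hu
  simp only [Cross, mapTriple, group, h₁, h₂, h₃]
  clear h₁ h₂ h₃ ht
  rcases hu with rfl | rfl | rfl | rfl <;> dsimp only <;>
    refine ⟨?_, ?_, ?_, ?_⟩ <;> grind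

theorem masterSeventyTwo_packs : Packs (6 * 12) masterSeventyTwo := by
  refine cellBlocks_packs.append (doubleBlocks_packs.append (cqsBlocks_packs.append
    pairsBlocks_packs fun t h₁ h₂ => ?_) fun t h₁ h₂ => ?_) fun t h₁ h₂ => ?_
  · have h₁ := cqsBlocks_spec h₁
    have h₂ := pairsBlocks_spec h₂
    omega
  · have h₁ := doubleBlocks_spec h₁
    rw [triples_append, List.mem_append] at h₂
    rcases h₂ with h₂ | h₂
    · have h₂ := cqsBlocks_spec h₂
      omega
    · have h₂ := pairsBlocks_spec h₂
      omega
  · have h₁ := cellBlocks_spec h₁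
    rw [triples_append, triples_append, List.mem_append, List.mem_append] at h₂
    rcases h₂ with h₂ | h₂ | h₂
    · exact h₁.2.1 (doubleBlocks_spec h₂).2
    · have h₂ := cqsBlocks_spec h₂
      omega
    · have h₂ := pairsBlocks_spec h₂
      omega

theorem masterSeventyTwo_cross {t : ℕ × ℕ × ℕ} (ht : t ∈ triples masterSeventyTwo) :
    Cross 11 (mapTriple (· / 6) t) := by
  rw [masterSeventyTwo, triples_append, triples_append _ (_ ++ _), triples_append (mapQuads _ _),
    List.mem_append, List.mem_append, List.mem_append] at ht
  rcases ht with ht | ht | ht | ht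
  exacts [(cellBlocks_spec ht).1, (doubleBlocks_spec ht).1, (cqsBlocks_spec ht).1,
    (pairsBlocks_spec ht).1]

theorem length_masterSeventyTwo : masterSeventyTwo.length = 13203 := by
  simp only [masterSeventyTwo, List.length_append, length_inflate, length_inflatePairs,
    length_mapQuads]
  decide +kernel

theorem countP_masterSeventyTwo :
    masterSeventyTwo.countP (fun q => Nat.beq q.d 71) = 540 := by
  have h₁ : (inflatePairs 6 pairsSix pairsTwelve).countP (fun q => Nat.beq q.d 71) = 0 := by
    refine countP_eq_zero_of_triples fun t ht hd => ?_
    have := pairsTwelve_spec.2 _ (mem_of_mem_inflatePairs (by norm_num) pairsSix_div ht).1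
    simp [hd] at this
  have h₂ := countP_eq_zero_of_triples (z := 71) fun t ht => by
    have := doubleBlocks_spec (t := t) ht
    omega
  have h₃ := countP_eq_zero_of_triples (z := 71) fun t ht => by
    have := cqsBlocks_spec (t := t) ht
    omega
  have h₄ : (mapQuads (lift 6 fun i => if i < 3 then 3 * i else i + 6) pairsEighteen).countP
      (fun q => Nat.beq q.d 71) = pairsEighteen.countP fun q => Nat.beq q.d 35 := by
    rw [mapQuads, List.countP_map]
    refine List.countP_congr fun q hq => ?_
    have := (pairsEighteen_packs.1.1 q hq).2.2.2
    simp only [Function.comp, Nat.beq_eq, lift]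
    grind
  rw [masterSeventyTwo, List.countP_append, List.countP_append, List.countP_append,
    List.countP_append (l₁ := mapQuads _ cqsEighteen), h₁, h₂, h₃, h₄,
    countP_inflate (by norm_num) _ (fun q hq => (transversalSix_div q hq).2.2.2) 11 (r := 5)
      (by norm_num)]
  decide +kernel

theorem packingEleven_packs : Packs 11 packingEleven := by
  refine (packs_of_checkPacks (p := fun _ => true) ?_).1
  decide +kernel

theorem packingFortySeven_packs : Packs 47 packingFortySeven ∧
    ∀ t ∈ triples packingFortySeven, t.1 < 36 := by
  have h : Packs 47 packingFortySeven ∧ ∀ q ∈ packingFortySeven, Nat.blt q.b 36 = true := by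
    refine packs_of_checkPacks ?_
    decide +kernel
  refine ⟨h.1, fun t ht => ?_⟩
  obtain ⟨q, hq, ht⟩ := mem_triples.1 ht
  have h₁ := h.1.1 q hq
  have h₂ := h.2 q hq
  rw [Nat.blt_eq] at h₂
  rw [Quad.mem_triples] at ht
  rcases ht with rfl | rfl | rfl | rfl <;> dsimp only <;> omega

theorem packingThirtyFive_packs : Packs 35 packingThirtyFive ∧
    ∀ t ∈ triples packingThirtyFive, t.1 < 24 := by
  have h : Packs 35 packingThirtyFive ∧ ∀ q ∈ packingThirtyFive, Nat.blt q.b 24 = true := by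
    refine packs_of_checkPacks ?_
    decide +kernel
  refine ⟨h.1, fun t ht => ?_⟩
  obtain ⟨q, hq, ht⟩ := mem_triples.1 ht
  have h₁ := h.1.1 q hq
  have h₂ := h.2 q hq
  rw [Nat.blt_eq] at h₂
  rw [Quad.mem_triples] at ht
  rcases ht with rfl | rfl | rfl | rfl <;> dsimp only <;> omega

/-- The blocks over triples of points of a master design with `g + 1` cells of six points that are
not inside the union of a group and the stem, where every point is doubled and the very last point
is deleted. -/
def doubleMaster (g : ℕ) (M : List Quad) : List Quad :=
  (inflate 2 transversalTwo M).filter (fun q => Nat.blt q.d (12 * g + 11)) ++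
    inflatePairs 2 [⟨0, 1, 2, 3⟩] (crossPairs 18 (6 * g))

/-- A copy of `packingFortySeven` on a group of three cells and the last cell. -/
def fillThree (g i : ℕ) : List Quad :=
  mapQuads (lift 12 fun j => if j < 3 then 3 * i + j else g) packingFortySeven

/-- A copy of `packingThirtyFive` on the last two cells before the last one and the last cell. -/
def fillTwo (g : ℕ) : List Quad :=
  mapQuads (lift 12 fun j => j + (g - 2)) packingThirtyFive

/-- A copy of `packingEleven` on the last cell. -/
def fillStem (g : ℕ) : List Quad :=
  mapQuads (lift 12 fun _ => g) packingEleven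

/-- The packing obtained from `doubleMaster` by filling in three groups and the stem. -/
def fill (g : ℕ) (M : List Quad) : List Quad :=
  doubleMaster g M ++ (fillThree g 0 ++ (fillThree g 1 ++ (fillThree g 2 ++ fillStem g)))

theorem doubleMaster_packs {g : ℕ} {M : List Quad} (hM : Packs (6 * (g + 1)) M) :
    Packs (12 * g + 11) (doubleMaster g M) := by
  have h := Packs.inflate (by norm_num) transversalTwo_packs transversalTwo_div hM
  have hsub := List.filter_sublist (p := fun q : Quad => Nat.blt q.d (12 * g + 11))
    (l := inflate 2 transversalTwo M)
  have hp := pairsTwo_packs.inflatePairs (by norm_num) pairsTwo_div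
    (nodup_crossPairs 18 (6 * g)) fun p hp => lt_of_mem_crossPairs hp
  refine Packs.append ⟨fun q hq => ?_, h.2.sublist (hsub.flatMap _)⟩
    (hp.mono (by omega)) fun t h₁ h₂ => ?_
  · have h₁ := h.1 q (hsub.subset hq)
    have h₂ := List.of_mem_filter hq
    rw [Nat.blt_eq] at h₂
    exact ⟨h₁.1, h₁.2.1, h₁.2.2.1, h₂⟩
  · have h₁ := hM.lt (mapTriple_mem_of_mem_inflate (by norm_num) transversalTwo_div
      ((hsub.flatMap _).subset h₁))
    have h₂ := mem_of_mem_inflatePairs (by norm_num) pairsTwo_div h₂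
    dsimp only [mapTriple] at h₁
    omega

theorem doubleMaster_cross {g : ℕ} (hg : g ≤ 11) {M : List Quad}
    (hM : ∀ t ∈ triples M, Cross g (mapTriple (· / 6) t)) {t : ℕ × ℕ × ℕ}
    (ht : t ∈ triples (doubleMaster g M)) : Cross g (mapTriple (· / 12) t) := by
  rw [doubleMaster, triples_append, List.mem_append] at ht
  rcases ht with ht | ht
  · obtain ⟨q, hq, ht⟩ := mem_triples.1 ht
    have h := hM _ (mapTriple_mem_of_mem_inflate (by norm_num) transversalTwo_div
      (mem_triples.2 ⟨q, List.mem_of_mem_filter hq, ht⟩))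
    simpa only [mapTriple, Nat.div_div_eq_div_mul] using h
  · obtain ⟨h₁, h₂⟩ := mem_of_mem_inflatePairs (by norm_num) pairsTwo_div ht
    rw [mem_crossPairs] at h₁
    dsimp only at h₁
    have h₀ : ∀ c < g, group g c = c / 3 := fun c hc => if_pos hc
    rw [Cross, mapTriple, h₀ (t.1 / 12) (by omega), h₀ (t.2.1 / 12) (by omega),
      h₀ (t.2.2 / 12) (by omega)]
    omega

theorem fillThree_packs {g i : ℕ} (hg : 3 * i + 3 ≤ g) : Packs (12 * g + 11) (fillThree g i) := by
  refine packingFortySeven_packs.1.mapQuads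
    (fun x y hxy hy => lift_lt_lift (by norm_num) hxy fun h => ?_) fun x hx => ?_
  · grind
  · simp only [lift]
    grind

theorem fillThree_spec {g i : ℕ} (hg : 3 * i + 3 ≤ g) {t : ℕ × ℕ × ℕ}
    (ht : t ∈ triples (fillThree g i)) :
    ¬Cross g (mapTriple (· / 12) t) ∧ group g (t.1 / 12) = i := by
  obtain ⟨u, hu, h₁, h₂, h₃⟩ := mem_triples_lift (by norm_num) ht
  have h₄ := packingFortySeven_packs.2 u hu
  simp only [Cross, mapTriple, group, h₁, h₂, h₃]
  clear h₁ h₂ h₃ ht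
  refine ⟨?_, ?_⟩ <;> grind

theorem fillTwo_packs {g : ℕ} (hg : 2 ≤ g) : Packs (12 * g + 11) (fillTwo g) := by
  refine packingThirtyFive_packs.1.mapQuads
    (fun x y hxy hy => lift_lt_lift (by norm_num) hxy fun h => by omega) fun x hx => ?_
  simp only [lift]
  omega

theorem fillTwo_spec {t : ℕ × ℕ × ℕ} (ht : t ∈ triples (fillTwo 11)) :
    ¬Cross 11 (mapTriple (· / 12) t) ∧ group 11 (t.1 / 12) = 3 := by
  obtain ⟨u, hu, h₁, h₂, h₃⟩ := mem_triples_lift (by norm_num) ht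
  have h₄ := packingThirtyFive_packs.2 u hu
  have h₅ := packingThirtyFive_packs.1.lt hu
  simp only [Cross, mapTriple, group, h₁, h₂, h₃]
  clear h₁ h₂ h₃ ht
  refine ⟨?_, ?_⟩ <;> grind

theorem fillStem_packs (g : ℕ) : Packs (12 * g + 11) (fillStem g) := by
  refine packingEleven_packs.mapQuads
    (fun x y hxy hy => lift_lt_lift (by norm_num) hxy fun h => by omega) fun x hx => ?_
  simp only [lift]
  omega

theorem fillStem_spec {g : ℕ} {t : ℕ × ℕ × ℕ} (ht : t ∈ triples (fillStem g)) :
    ¬Cross g (mapTriple (· / 12) t) ∧ group g (t.1 / 12) = 9 := by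
  obtain ⟨u, hu, h₁, h₂, h₃⟩ := mem_triples_lift (by norm_num) ht
  simp [Cross, mapTriple, group, h₁, h₂, h₃]

theorem fill_packs {g : ℕ} (hg : 9 ≤ g) (hg' : g ≤ 11) {M : List Quad} (hM : Packs (6 * (g + 1)) M)
    (hM' : ∀ t ∈ triples M, Cross g (mapTriple (· / 6) t)) : Packs (12 * g + 11) (fill g M) := by
  refine (doubleMaster_packs hM).append ((fillThree_packs (by omega)).append
    ((fillThree_packs (by omega)).append ((fillThree_packs (by omega)).append (fillStem_packs g)
    fun t h₁ h₂ => ?_) fun t h₁ h₂ => ?_) fun t h₁ h₂ => ?_) fun t h₁ h₂ => ?_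
  · have h₁ := (fillThree_spec (by omega) h₁).2
    have h₂ := (fillStem_spec h₂).2
    omega
  · have h₁ := (fillThree_spec (by omega) h₁).2
    simp only [triples_append, List.mem_append] at h₂
    rcases h₂ with h₂ | h₂
    · have h₂ := (fillThree_spec (by omega) h₂).2
      omega
    · have h₂ := (fillStem_spec h₂).2
      omega
  · have h₁ := (fillThree_spec (by omega) h₁).2
    simp only [triples_append, List.mem_append] at h₂
    rcases h₂ with h₂ | h₂ | h₂
    · have h₂ := (fillThree_spec (by omega) h₂).2
      omega
    · have h₂ := (fillThree_spec (by omega) h₂).2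
      omega
    · have h₂ := (fillStem_spec h₂).2
      omega
  · have h₁ := doubleMaster_cross hg' hM' h₁
    simp only [triples_append, List.mem_append] at h₂
    rcases h₂ with h₂ | h₂ | h₂ | h₂
    exacts [(fillThree_spec (by omega) h₂).1 h₁, (fillThree_spec (by omega) h₂).1 h₁,
      (fillThree_spec (by omega) h₂).1 h₁, (fillStem_spec h₂).1 h₁]

theorem fill_spec {g : ℕ} (hg : 9 ≤ g) (hg' : g ≤ 11) {M : List Quad}
    (hM : ∀ t ∈ triples M, Cross g (mapTriple (· / 6) t)) {t : ℕ × ℕ × ℕ}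
    (ht : t ∈ triples (fill g M)) :
    Cross g (mapTriple (· / 12) t) ∨ group g (t.1 / 12) ≠ 3 := by
  simp only [fill, triples_append, List.mem_append] at ht
  rcases ht with ht | ht | ht | ht | ht
  · exact .inl (doubleMaster_cross hg' hM ht)
  · exact .inr (by rw [(fillThree_spec (by omega) ht).2]; decide)
  · exact .inr (by rw [(fillThree_spec (by omega) ht).2]; decide)
  · exact .inr (by rw [(fillThree_spec (by omega) ht).2]; decide)
  · exact .inr (by rw [(fillStem_spec ht).2]; decide)

theorem length_doubleMaster {g : ℕ} {M : List Quad} (hM : Packs (6 * (g + 1)) M) :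
    (doubleMaster g M).length + 4 * M.countP (fun q => Nat.beq q.d (6 * g + 5)) =
      8 * M.length + (crossPairs 18 (6 * g)).length := by
  have h := Packs.inflate (by norm_num) transversalTwo_packs transversalTwo_div hM
  have hlen := length_inflate 2 transversalTwo M
  have hcount := countP_inflate (by norm_num) M (fun q hq => (transversalTwo_div q hq).2.2.2)
    (6 * g + 5) (r := 1) (by norm_num)
  have hsum := List.length_eq_countP_add_countP (fun q : Quad => Nat.blt q.d (12 * g + 11))
    (l := inflate 2 transversalTwo M)
  have hlast : (inflate 2 transversalTwo M).countP
      (fun q => decide ¬(Nat.blt q.d (12 * g + 11) = true)) =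
      (inflate 2 transversalTwo M).countP (fun q => Nat.beq q.d (2 * (6 * g + 5) + 1)) := by
    refine List.countP_congr fun q hq => ?_
    have := (h.1 q hq).2.2.2
    rw [decide_eq_true_eq, Nat.blt_eq, Nat.beq_eq]
    omega
  have h₈ : transversalTwo.length = 8 := rfl
  have h₄ : transversalTwo.countP (fun q => Nat.beq q.d (2 * 3 + 1)) = 4 := by decide
  rw [h₈] at hlen
  rw [h₄] at hcount
  rw [doubleMaster, List.length_append, length_inflatePairs, ← List.countP_eq_length_filter]
  simp only [List.length_cons, List.length_nil]
  omega

theorem length_fill (g : ℕ) (M : List Quad) :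
    (fill g M).length = (doubleMaster g M).length + 11807 := by
  have h₁ : packingFortySeven.length = 3924 := by decide +kernel
  have h₂ : packingEleven.length = 35 := by decide +kernel
  simp only [fill, fillThree, fillStem, List.length_append, length_mapQuads, h₁, h₂]

theorem exists_packs_119 : ∃ L, Packs 119 L ∧ L.length = 67859 := by
  refine ⟨fill 9 masterSixty, fill_packs (by norm_num) (by norm_num) masterSixty_packs
    fun t ht => masterSixty_cross ht, ?_⟩
  have h := length_doubleMaster (g := 9) masterSixty_packs
  have h₁ : (crossPairs 18 (6 * 9)).length = 972 := by decide +kernel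
  have h₂ : masterSixty.countP (fun q => Nat.beq q.d (6 * 9 + 5)) = 324 := countP_masterSixty
  rw [h₂, length_masterSixty, h₁] at h
  rw [length_fill]
  generalize (doubleMaster 9 masterSixty).length = k at h ⊢
  omega

theorem exists_packs_143 : ∃ L, Packs 143 L ∧ L.length = 118439 := by
  refine ⟨fill 11 masterSeventyTwo ++ fillTwo 11, (fill_packs (by norm_num) (by norm_num)
    masterSeventyTwo_packs
    fun t ht => masterSeventyTwo_cross ht).append (fillTwo_packs (by norm_num))
    fun t h₁ h₂ => ?_, ?_⟩
  · have h₁ := fill_spec (by norm_num) (by norm_num) (fun t ht => masterSeventyTwo_cross ht) h₁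
    have h₂ := fillTwo_spec h₂
    tauto
  have h := length_doubleMaster (g := 11) masterSeventyTwo_packs
  have h₁ : (crossPairs 18 (6 * 11)).length = 1620 := by decide +kernel
  have h₂ : packingThirtyFive.length = 1548 := by decide +kernel
  have h₃ : masterSeventyTwo.countP (fun q => Nat.beq q.d (6 * 11 + 5)) = 540 :=
    countP_masterSeventyTwo
  rw [h₃, length_masterSeventyTwo, h₁] at h
  rw [List.length_append, length_fill, fillTwo, length_mapQuads, h₂]
  generalize (doubleMaster 11 masterSeventyTwo).length = k at h ⊢
  omega

/-- The block of points of `Fin n` given by a list of four numbers. -/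
def Quad.toFinset (n : ℕ) (q : Quad) : Finset (Fin n) :=
  Finset.univ.filter fun x => x.val = q.a ∨ x.val = q.b ∨ x.val = q.c ∨ x.val = q.d

theorem Quad.card_toFinset {n : ℕ} {q : Quad} (h : q.a < q.b ∧ q.b < q.c ∧ q.c < q.d ∧ q.d < n) :
    (q.toFinset n).card = 4 := by
  have e : q.toFinset n =
      {⟨q.a, by omega⟩, ⟨q.b, by omega⟩, ⟨q.c, by omega⟩, ⟨q.d, by omega⟩} := by
    ext x
    simp [Quad.toFinset, Fin.ext_iff]
  rw [e, Finset.card_insert_of_notMem, Finset.card_insert_of_notMem, Finset.card_pair] <;>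
    simp only [Finset.mem_insert, Finset.mem_singleton, Fin.mk.injEq, ne_eq] <;> omega

/-- A triple of points of a block is one of its triples when listed in increasing order. -/
theorem Quad.mem_triples_of_subset {n : ℕ} {q : Quad} (h : q.a < q.b ∧ q.b < q.c ∧ q.c < q.d)
    {x y z : Fin n} (hxy : x < y) (hyz : y < z) (hq : {x, y, z} ⊆ q.toFinset n) :
    (x.val, y.val, z.val) ∈ q.triples := by
  simp only [Quad.toFinset, Finset.insert_subset_iff, Finset.singleton_subset_iff,
    Finset.mem_filter, Finset.mem_univ, true_and] at hq
  rw [Fin.lt_def] at hxy hyz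
  simp only [Quad.mem_triples, Prod.mk.injEq]
  omega

theorem exists_lt_lt_of_card_eq_three {n : ℕ} {t : Finset (Fin n)} (ht : t.card = 3) :
    ∃ x y z, x < y ∧ y < z ∧ t = {x, y, z} := by
  refine ⟨t.orderEmbOfFin ht 0, t.orderEmbOfFin ht 1, t.orderEmbOfFin ht 2, by simp, by simp, ?_⟩
  refine (Finset.image_orderEmbOfFin_univ t ht).symm.trans ?_
  rw [show (Finset.univ : Finset (Fin 3)) = {0, 1, 2} from rfl]
  simp only [Finset.image_insert, Finset.image_singleton]

theorem Packs.eq_of_mem_triples {v : ℕ} {L : List Quad} (h : Packs v L) {q r : Quad} (hq : q ∈ L)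
    (hr : r ∈ L) {t : ℕ × ℕ × ℕ} (htq : t ∈ q.triples) (htr : t ∈ r.triples) : q = r := by
  by_contra hne
  have : Std.Symm (Function.onFun List.Disjoint Quad.triples) := ⟨fun _ _ hd => hd.symm⟩
  exact (List.nodup_flatMap.1 h.2).2.forall hq hr hne htq htr

theorem Packs.nodup_map_toFinset {n : ℕ} {L : List Quad} (h : Packs n L) :
    (L.map (Quad.toFinset n)).Nodup := by
  rw [List.Nodup, List.pairwise_map]
  refine (List.nodup_flatMap.1 h.2).2.imp_of_mem fun {q r} hq hr hd he => ?_
  have h₁ := h.1 q hq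
  have h₂ := h.1 r hr
  refine hd (Quad.mem_triples.2 (.inl rfl)) (Quad.mem_triples_of_subset (n := n)
    (x := ⟨q.a, by omega⟩) (y := ⟨q.b, by omega⟩) (z := ⟨q.c, by omega⟩)
    ⟨h₂.1, h₂.2.1, h₂.2.2.1⟩ h₁.1 h₁.2.1 ?_)
  rw [← he]
  simp [Quad.toFinset, Finset.insert_subset_iff]

theorem Packs.exists_isPQS {n : ℕ} {L : List Quad} (h : Packs n L) :
    ∃ B : Finset (Finset (Fin n)), IsPQS n B ∧ B.card = L.length := by
  refine ⟨(L.map (Quad.toFinset n)).toFinset, ⟨fun b hb => ?_, fun t ht => ?_⟩, ?_⟩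
  · obtain ⟨q, hq, rfl⟩ := List.mem_map.1 (List.mem_toFinset.1 hb)
    exact Quad.card_toFinset (h.1 q hq)
  · obtain ⟨x, y, z, hxy, hyz, rfl⟩ := exists_lt_lt_of_card_eq_three ht
    refine Finset.card_le_one.2 fun b hb c hc => ?_
    rw [Finset.mem_filter, List.mem_toFinset, List.mem_map] at hb hc
    obtain ⟨⟨q, hq, rfl⟩, hqt⟩ := hb
    obtain ⟨⟨r, hr, rfl⟩, hrt⟩ := hc
    have h₁ := h.1 q hq
    have h₂ := h.1 r hr
    rw [h.eq_of_mem_triples hq hr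
      (Quad.mem_triples_of_subset ⟨h₁.1, h₁.2.1, h₁.2.2.1⟩ hxy hyz hqt)
      (Quad.mem_triples_of_subset ⟨h₂.1, h₂.2.1, h₂.2.2.1⟩ hxy hyz hrt)]
  · rw [List.toFinset_card_of_nodup h.nodup_map_toFinset, List.length_map]

/-- A bound on the number of blocks containing a set from a bound for the sets with one more
point. -/
theorem card_filter_subset_le {α : Type*} [Fintype α] [DecidableEq α] {B : Finset (Finset α)}
    {k D : ℕ} (hB : ∀ b ∈ B, b.card = k) (s : Finset α) (hs : s.card < k)
    (hD : ∀ t : Finset α, t.card = s.card + 1 → (B.filter (t ⊆ ·)).card ≤ D) :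
    (B.filter (s ⊆ ·)).card ≤ (Fintype.card α - s.card) * D / (k - s.card) := by
  rw [Nat.le_div_iff_mul_le (by omega), ← Finset.card_compl]
  refine Finset.card_mul_le_card_mul (fun b x => x ∈ b) (fun b hb => ?_) fun x hx => ?_
  · rw [Finset.mem_filter] at hb
    rw [← hB b hb.1, ← Finset.card_sdiff_of_subset hb.2]
    refine Finset.card_le_card fun x hx => ?_
    simpa [Finset.bipartiteAbove, and_comm] using hx
  · rw [Finset.mem_compl] at hx
    refine le_trans (Finset.card_le_card fun b hb => ?_) (hD _ (Finset.card_insert_of_notMem hx))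
    simp only [Finset.bipartiteBelow, Finset.mem_filter] at hb
    exact Finset.mem_filter.2 ⟨hb.1.1, Finset.insert_subset hb.2 hb.1.2⟩

theorem IsPQS.card_le {n : ℕ} {B : Finset (Finset (Fin n))} (h : IsPQS n B) :
    B.card ≤ n * ((n - 1) * ((n - 2) / 2) / 3) / 4 := by
  have h₂ : ∀ s : Finset (Fin n), s.card = 2 → (B.filter (s ⊆ ·)).card ≤ (n - 2) / 2 :=
    fun s hs => by
      have := card_filter_subset_le h.1 s (by omega) (D := 1) fun t ht => h.2 t (by omega)
      simpa [hs] using this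
  have h₁ : ∀ s : Finset (Fin n), s.card = 1 →
      (B.filter (s ⊆ ·)).card ≤ (n - 1) * ((n - 2) / 2) / 3 := fun s hs => by
    have := card_filter_subset_le h.1 s (by omega) fun t ht => h₂ t (by omega)
    simpa [hs] using this
  have := card_filter_subset_le h.1 ∅ (by simp) fun t ht => h₁ t (by simpa using ht)
  simpa using this

theorem packingNumber_eq_johnsonBound {n : ℕ} (hn : n % 6 ≠ 0) {L : List Quad} (h : Packs n L)
    (hL : L.length = johnsonBound n) : packingNumber n = johnsonBound n := by
  have hle : ∀ N ∈ {N | ∃ B : Finset (Finset (Fin n)), IsPQS n B ∧ B.card = N},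
      N ≤ johnsonBound n := by
    rintro _ ⟨B, hB, rfl⟩
    rw [johnsonBound, if_neg hn]
    exact hB.card_le
  obtain ⟨B, hB, hcard⟩ := h.exists_isPQS
  have hmem : johnsonBound n ∈ {N | ∃ B : Finset (Finset (Fin n)), IsPQS n B ∧ B.card = N} :=
    ⟨B, hB, hcard.trans hL⟩
  exact le_antisymm (csSup_le ⟨_, hmem⟩ hle) (le_csSup ⟨_, hle⟩ hmem)

/-- For k ∈ {19, 23}, A(6k+5,4,4) = J(6k+5,4,4). -/
theorem packingNumber_119_143 :
    packingNumber 119 = johnsonBound 119 ∧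
    packingNumber 143 = johnsonBound 143 := by
  obtain ⟨L, hL, hlen⟩ := exists_packs_119
  obtain ⟨L', hL', hlen'⟩ := exists_packs_143
  exact ⟨packingNumber_eq_johnsonBound (by decide) hL hlen,
    packingNumber_eq_johnsonBound (by decide) hL' hlen'⟩
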